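/- Let G = (L,R,E) be a d-regular bipartite graph with |L| = |R| = n satisfying the λ-expander mixing property. Let σ be a type, D a natural number, and Ẽ : ℝ[σ] → ℝ an ℝ-linear functional with Ẽ(p²) ≥ 0 for every polynomial p of total degree at most D. Let {X_ℓ}_{ℓ∈L} and {Y_r}_{r∈R} be collections of polynomials in ℝ[σ], each of total degree at most D. Then |E_{(ℓ,r)∈E}[Ẽ(X_ℓ·Y_r)] − E_{ℓ∈L, r∈R}[Ẽ(X_ℓ·Y_r)]| ≤ λ·√(E_{ℓ∈L}[Ẽ(X_ℓ²)])·√(E_{r∈R}[Ẽ(Y_r²)]). -/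

import Mathlib

open scoped BigOperators
open scoped BigOperators

/-- A `d`-regular bipartite (multi)graph with left vertices `L`, right vertices `R` and
edge set `E`: each edge `e` has a left endpoint `eL e` and a right endpoint `eR e`, and
each vertex comes with a fixed ordering of the `d` edges incident to it. -/
structure BipartiteGraph (L R E : Type*) (d : ℕ) where
  eL : E → L
  eR : E → R
  oL : (ℓ : L) → Fin d ≃ {e : E // eL e = ℓ}
  oR : (r : R) → Fin d ≃ {e : E // eR e = r}

namespace BipartiteGraph

variable {L R E : Type*} {d : ℕ}

/-- The block of `z : E → A` at a left vertex `ℓ`, an element of `A^d`. -/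
def blockL {A : Type*} (G : BipartiteGraph L R E d) (z : E → A) (ℓ : L) : Fin d → A :=
  fun i => z (G.oL ℓ i).1

/-- The block of `z : E → A` at a right vertex `r`, an element of `A^d`. -/
def blockR {A : Type*} (G : BipartiteGraph L R E d) (z : E → A) (r : R) : Fin d → A :=
  fun i => z (G.oR r i).1

/-- The `λ`-expander mixing property: for all `f : L → ℝ`, `g : R → ℝ`,
`|E_{(ℓ,r) ∈ E}[f(ℓ)g(r)] − E_ℓ[f]·E_r[g]| ≤ λ √(E_ℓ[f²]) √(E_r[g²])`. -/
def EML [Fintype L] [Fintype R] [Fintype E] (G : BipartiteGraph L R E d) (lam : ℝ) : Prop :=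
  ∀ (f : L → ℝ) (g : R → ℝ),
    |(∑ e, f (G.eL e) * g (G.eR e)) / (Fintype.card E : ℝ) -
        ((∑ ℓ, f ℓ) / (Fintype.card L : ℝ)) * ((∑ r, g r) / (Fintype.card R : ℝ))| ≤
      lam * Real.sqrt ((∑ ℓ, f ℓ ^ 2) / (Fintype.card L : ℝ)) *
        Real.sqrt ((∑ r, g r ^ 2) / (Fintype.card R : ℝ))

end BipartiteGraph

/-- The moments of finitely many low-degree polynomials under a functional that is nonnegative
on squares of low-degree polynomials form a Gram matrix of real vectors. -/
theorem exists_gram_of_pseudoexpectation {ι σ : Type*} [Fintype ι] (D : ℕ)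
    (pE : MvPolynomial σ ℝ →ₗ[ℝ] ℝ)
    (hpsd : ∀ p : MvPolynomial σ ℝ, p.totalDegree ≤ D → 0 ≤ pE (p ^ 2))
    (Z : ι → MvPolynomial σ ℝ) (hZ : ∀ i, (Z i).totalDegree ≤ D) :
    ∃ (m : ℕ) (v : Fin m → ι → ℝ), ∀ i j, pE (Z i * Z j) = ∑ k, v k i * v k j := by
  have hM : (Matrix.of fun i j => pE (Z i * Z j)).PosSemidef := by
    refine .of_dotProduct_mulVec_nonneg ?_ fun x => ?_
    · ext i j
      simp [mul_comm]
    · have hdeg : (∑ i, x i • Z i).totalDegree ≤ D :=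
        MvPolynomial.totalDegree_finsetSum_le fun i _ =>
          (MvPolynomial.totalDegree_smul_le _ _).trans (hZ i)
      refine (hpsd _ hdeg).trans_eq ?_
      rw [sq, Finset.sum_mul_sum]
      simp only [map_sum, smul_mul_smul_comm, map_smul, smul_eq_mul,
        dotProduct, Matrix.mulVec, Matrix.of_apply, star_trivial, Finset.mul_sum]
      exact Finset.sum_congr rfl fun i _ => Finset.sum_congr rfl fun j _ => by ring
  obtain ⟨m, v, hv⟩ := Matrix.posSemidef_iff_eq_sum_vecMulVec.mp hM
  refine ⟨m, v, fun i j => ?_⟩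
  simpa [Matrix.sum_apply, Matrix.vecMulVec_apply] using congrFun (congrFun hv i) j

namespace BipartiteGraph

/-- The parameter of the expander mixing property is nonnegative on nonempty vertex sets. -/
theorem EML.nonneg {L R E : Type*} {d : ℕ} [Fintype L] [Fintype R] [Fintype E]
    [Nonempty L] [Nonempty R] {G : BipartiteGraph L R E d} {lam : ℝ} (h : G.EML lam) :
    0 ≤ lam := by
  simpa using (abs_nonneg _).trans (h (fun _ => 1) fun _ => 1)

/-- The expander mixing property for vector-valued functions. -/
theorem EML.abs_sum_le {L R E κ : Type*} {d : ℕ} [Fintype L] [Fintype R] [Fintype E]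
    [Fintype κ] [Nonempty L] [Nonempty R] {G : BipartiteGraph L R E d} {lam : ℝ}
    (h : G.EML lam) (f : κ → L → ℝ) (g : κ → R → ℝ) :
    |(∑ e, ∑ k, f k (G.eL e) * g k (G.eR e)) / (Fintype.card E : ℝ) -
        (∑ ℓ, ∑ r, ∑ k, f k ℓ * g k r) / ((Fintype.card L : ℝ) * Fintype.card R)| ≤
      lam * Real.sqrt ((∑ ℓ, ∑ k, f k ℓ ^ 2) / (Fintype.card L : ℝ)) *
        Real.sqrt ((∑ r, ∑ k, g k r ^ 2) / (Fintype.card R : ℝ)) := by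
  have hprod : ∑ ℓ, ∑ r, ∑ k, f k ℓ * g k r = ∑ k, (∑ ℓ, f k ℓ) * ∑ r, g k r := by
    simp only [Finset.sum_mul_sum]
    rw [Finset.sum_comm (s := (Finset.univ : Finset κ))]
    exact Finset.sum_congr rfl fun ℓ _ => Finset.sum_comm
  rw [hprod, Finset.sum_comm, Finset.sum_comm (s := (Finset.univ : Finset L)),
    Finset.sum_comm (s := (Finset.univ : Finset R))]
  simp only [Finset.sum_div, ← Finset.sum_sub_distrib]
  refine (Finset.abs_sum_le_sum_abs _ _).trans ?_
  have hcs := Real.sum_sqrt_mul_sqrt_le (Finset.univ : Finset κ)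
    (f := fun k => (∑ ℓ, f k ℓ ^ 2) / (Fintype.card L : ℝ))
    (g := fun k => (∑ r, g k r ^ 2) / (Fintype.card R : ℝ))
    (fun k => by positivity) (fun k => by positivity)
  have hk := Finset.sum_le_sum fun k (_ : k ∈ Finset.univ) => h (f k) (g k)
  simp only [mul_assoc, ← Finset.mul_sum] at hk ⊢
  simp only [mul_div_mul_comm]
  simp only [Finset.sum_div] at hk hcs ⊢
  exact hk.trans (mul_le_mul_of_nonneg_left hcs h.nonneg)

end BipartiteGraph

/-- (EML for pseudoexpectations.) Let `G` satisfy the `λ`-expander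
mixing property, and let `Ẽ : ℝ[σ] → ℝ` be linear with `Ẽ(p²) ≥ 0` for every `p` of total
degree at most `D`. For collections `{X_ℓ}`, `{Y_r}` of polynomials of total degree at
most `D`,
`|E_{(ℓ,r)∈E}[Ẽ(X_ℓ Y_r)] − E_{ℓ,r}[Ẽ(X_ℓ Y_r)]| ≤ λ √(E_ℓ[Ẽ(X_ℓ²)]) √(E_r[Ẽ(Y_r²)])`. -/
theorem stmt10 (L R E : Type*) [Fintype L] [Fintype R] [Fintype E]
    (n d : ℕ) (hn : 0 < n) (hd : 0 < d)
    (hL : Fintype.card L = n) (hR : Fintype.card R = n)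
    (G : BipartiteGraph L R E d)
    (lam : ℝ) (hEML : G.EML lam)
    (σ : Type*) (D : ℕ) (pE : MvPolynomial σ ℝ →ₗ[ℝ] ℝ)
    (hpsd : ∀ p : MvPolynomial σ ℝ, p.totalDegree ≤ D → 0 ≤ pE (p ^ 2))
    (X : L → MvPolynomial σ ℝ) (Y : R → MvPolynomial σ ℝ)
    (hX : ∀ ℓ, (X ℓ).totalDegree ≤ D) (hY : ∀ r, (Y r).totalDegree ≤ D) :
    |(∑ e, pE (X (G.eL e) * Y (G.eR e))) / (Fintype.card E : ℝ)
        - (∑ ℓ, ∑ r, pE (X ℓ * Y r)) / ((n : ℝ) * n)|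
      ≤ lam * Real.sqrt ((∑ ℓ, pE (X ℓ ^ 2)) / n)
          * Real.sqrt ((∑ r, pE (Y r ^ 2)) / n) := by
  have : Nonempty L := Fintype.card_pos_iff.mp (hL ▸ hn)
  have : Nonempty R := Fintype.card_pos_iff.mp (hR ▸ hn)
  obtain ⟨m, v, hv⟩ := exists_gram_of_pseudoexpectation D pE hpsd (Sum.elim X Y)
    (Sum.rec hX hY)
  have hXY : ∀ ℓ r, pE (X ℓ * Y r) = ∑ k, v k (.inl ℓ) * v k (.inr r) :=
    fun ℓ r => hv (.inl ℓ) (.inr r)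
  have hXX : ∀ ℓ, pE (X ℓ ^ 2) = ∑ k, v k (.inl ℓ) ^ 2 := fun ℓ => by
    simpa [sq] using hv (.inl ℓ) (.inl ℓ)
  have hYY : ∀ r, pE (Y r ^ 2) = ∑ k, v k (.inr r) ^ 2 := fun r => by
    simpa [sq] using hv (.inr r) (.inr r)
  have key := hEML.abs_sum_le (fun k ℓ => v k (.inl ℓ)) (fun k r => v k (.inr r))
  rw [hL, hR] at key
  simpa only [hXY, hXX, hYY] using key
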